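/- Define Z_π = ∫_{ℝ^d} exp(−U(θ))dθ and Z_{π_ρ} = ∫_{ℝ^d} exp(−U^ρ(θ))dθ, where U^ρ(θ) = Σ_i U_i^ρ(A_iθ) and U_i^ρ(u) = −log ∫ exp(−U_i(z) − ‖z − u‖²/(2ρ²))(2πρ²)^{−d_i/2}dz. (i) If b = 1, d_1 = d and A_1 is of full rank, then Z_π = Z_{π_ρ} for every ρ > 0. (ii) More generally, if Assumptions (A0), (A2), (A4) and (A6) hold and det(Σ_i m_i A_iᵀA_i) > 0, then for ρ² ≤ 1/(6σ_U²), log(Z_π/Z_{π_ρ}) ≥ −E_π(B̄(θ)) − ρ⁴(2 + d)σ_U⁴, where B̄(θ) = (ρ²/2)Σ_i‖∇U_i(A_iθ)‖², E_π denotes expectation under π(θ) = exp(−U(θ))/Z_π, σ_U² = ‖AᵀA‖(max_i M_i)²/m_U, m_U = λ_min(Σ_i m_i A_iᵀA_i) and A = [A_1ᵀ,…,A_bᵀ]ᵀ. -/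

import Mathlib

/-!
STATEMENT 18: Normalizing constants Z_π = ∫exp(−U) and Z_{π_ρ} = ∫exp(−U^ρ).
(i) If b = 1, d₁ = d and A₁ is full rank, then Z_π = Z_{π_ρ} for every ρ > 0.
(ii) Under (A0), (A2), (A4), (A6) and det(Σᵢ mᵢAᵢᵀAᵢ) > 0, for ρ² ≤ 1/(6σ_U²):
log(Z_π/Z_{π_ρ}) ≥ −E_π(B̄) − ρ⁴(2+d)σ_U⁴.
-/

open MeasureTheory Matrix
open scoped ENNReal BigOperators RealInnerProductSpace

noncomputable section

abbrev EV (n : ℕ) := EuclideanSpace ℝ (Fin n)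

/-- Action of a matrix on a Euclidean vector. -/
def mvec {m n : ℕ} (A : Matrix (Fin m) (Fin n) ℝ) (x : EV n) : EV m :=
  (EuclideanSpace.equiv (Fin m) ℝ).symm (A.mulVec (EuclideanSpace.equiv (Fin n) ℝ x))

/-- Spectral (ℓ²-operator) norm of a matrix. -/
def specNorm {m n : Type*} [Fintype m] [Fintype n] [DecidableEq n]
    (A : Matrix m n ℝ) : ℝ :=
  ‖LinearMap.toContinuousLinearMap (Matrix.toEuclideanLin A)‖

/-- The matrix obtained by stacking `A 1, …, A b` one upon another. -/
def stacked {d b : ℕ} (dd : Fin b → ℕ) (A : ∀ i, Matrix (Fin (dd i)) (Fin d) ℝ) :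
    Matrix ((i : Fin b) × Fin (dd i)) (Fin d) ℝ :=
  Matrix.of fun p j => A p.1 p.2 j

/-- Probability measure with (unnormalized) density `f` w.r.t. the volume measure. -/
def densMeasure {α : Type*} [MeasureSpace α] (f : α → ℝ) : Measure α :=
  (∫⁻ x, ENNReal.ofReal (f x))⁻¹ • (volume.withDensity fun x => ENNReal.ofReal (f x))

/-- The potential `U_i^ρ` obtained by Gaussian smoothing of `U`. -/
def Uirho {n : ℕ} (U : EV n → ℝ) (ρ : ℝ) (u : EV n) : ℝ :=
  -Real.log (∫ z : EV n,
    Real.exp (-U z - ‖z - u‖ ^ 2 / (2 * ρ ^ 2)) / (2 * Real.pi * ρ ^ 2) ^ ((n : ℝ) / 2))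

lemma bm_compact (K L : Set ℝ) (hK : IsCompact K) (hL : IsCompact L) (hKn : K.Nonempty)
    (hLn : L.Nonempty) (C : Set ℝ) (hC : ∀ x ∈ K, ∀ y ∈ L, x + y ∈ C) :
    volume K + volume L ≤ volume C := by
  obtain ⟨k, hk, hkm⟩ := hK.exists_isGreatest hKn
  obtain ⟨l, hl, hlm⟩ := hL.exists_isLeast hLn
  have h1 : volume ((fun x => x + l) '' K) = volume K := by
    rw [Set.image_add_right]; exact measure_preimage_add_right _ _ _
  have h2 : volume ((fun y => k + y) '' L) = volume L := by
    rw [Set.image_add_left]; exact measure_preimage_add _ _ _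
  have hd : AEDisjoint volume ((fun x => x + l) '' K) ((fun y => k + y) '' L) := by
    refine measure_mono_null (t := {k + l}) ?_ (by simp)
    rintro z ⟨⟨x, hx, rfl⟩, ⟨y, hy, hxy⟩⟩
    have := hkm hx
    have := hlm hy
    simp only [Set.mem_singleton_iff] at *
    linarith
  rw [← h1, ← h2, ← measure_union₀ _ hd]
  · apply measure_mono
    rintro z (⟨x, hx, rfl⟩ | ⟨y, hy, rfl⟩)
    · exact hC _ hx _ hl
    · exact hC _ hk _ hy
  · exact (hL.image (by fun_prop)).measurableSet.nullMeasurableSet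

open scoped Pointwise in
lemma bm_one (A B C : Set ℝ) (hA : MeasurableSet A) (hB : MeasurableSet B) (hAn : A.Nonempty)
    (hBn : B.Nonempty) (t : ℝ) (ht : 0 < t) (ht1 : t < 1)
    (hC : ∀ x ∈ A, ∀ y ∈ B, t * x + (1 - t) * y ∈ C) :
    ENNReal.ofReal t * volume A + ENNReal.ofReal (1 - t) * volume B ≤ volume C := by
  obtain ⟨a, ha⟩ := hAn
  obtain ⟨b, hb⟩ := hBn
  have ht' : 0 < 1 - t := by linarith
  have key : ∀ K L : Set ℝ, K ⊆ A → L ⊆ B → IsCompact K → IsCompact L →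
      ENNReal.ofReal t * volume K + ENNReal.ofReal (1 - t) * volume L ≤ volume C := by
    intro K L hKA hLB hK hL
    have hs : ∀ (c : ℝ) (hc : 0 < c) (S : Set ℝ) (e : ℝ),
        ENNReal.ofReal c * volume S ≤ volume ((fun x => c * x) '' (insert e S)) := by
      intro c hc S e
      have : (fun x => c * x) '' (insert e S) = c • (insert e S) := rfl
      rw [this, Measure.addHaar_smul]
      simp only [Module.finrank_self, pow_one, abs_of_pos hc]
      gcongr
      exact Set.subset_insert _ _
    refine (add_le_add (hs t ht K a) (hs (1-t) ht' L b)).trans ?_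
    refine bm_compact _ _ ((hK.insert a).image (by fun_prop)) ((hL.insert b).image (by fun_prop))
      ((Set.insert_nonempty _ _).image _) ((Set.insert_nonempty _ _).image _) _ ?_
    rintro _ ⟨x, hx, rfl⟩ _ ⟨y, hy, rfl⟩
    refine hC x ?_ y ?_
    · exact Set.insert_subset ha hKA hx
    · exact Set.insert_subset hb hLB hy
  rw [hA.measure_eq_iSup_isCompact, hB.measure_eq_iSup_isCompact]
  simp only [ENNReal.mul_iSup]
  refine ENNReal.iSup_add_iSup_le ?_ 
  intro K L
  by_cases hKA : K ⊆ A
  swap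
  · simp only [hKA, ciSup_false, bot_eq_zero, zero_add]
    by_cases hLB : L ⊆ B
    swap
    · simp [hLB]
    by_cases hL : IsCompact L
    swap
    · simp [hL]
    simpa [hL, hLB] using key ∅ L (by simp) hLB (by simp) hL
  by_cases hK : IsCompact K
  swap
  · simp only [hK, hKA, ciSup_false, bot_eq_zero, zero_add, iSup_true, mul_zero]
    by_cases hLB : L ⊆ B
    swap
    · simp [hLB]
    by_cases hL : IsCompact L
    swap
    · simp [hL]
    simpa [hL, hLB] using key ∅ L (by simp) hLB (by simp) hL
  by_cases hLB : L ⊆ B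
  swap
  · simpa [hLB, hKA, hK] using key K ∅ hKA (by simp) hK (by simp)
  by_cases hL : IsCompact L
  swap
  · simpa [hL, hLB, hKA, hK] using key K ∅ hKA (by simp) hK (by simp)
  simpa [hL, hLB, hKA, hK] using key K L hKA hLB hK hL

/-- normalized one-dimensional Prekopa–Leindler -/
lemma pl_norm (u v w : ℝ → ℝ) (hu : Measurable u) (hv : Measurable v) (hw : Measurable w)
    (hu0 : ∀ x, 0 ≤ u x) (hv0 : ∀ x, 0 ≤ v x) (hw0 : ∀ x, 0 ≤ w x)
    (hu1 : ∀ x, u x ≤ 1) (hv1 : ∀ x, v x ≤ 1)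
    (hus : ∀ r < 1, ∃ x, r < u x) (hvs : ∀ r < 1, ∃ x, r < v x)
    (t : ℝ) (ht : 0 < t) (ht1 : t < 1)
    (h : ∀ x y, u x ^ t * v y ^ (1 - t) ≤ w (t * x + (1 - t) * y)) :
    ENNReal.ofReal t * (∫⁻ x, ENNReal.ofReal (u x)) +
      ENNReal.ofReal (1 - t) * (∫⁻ x, ENNReal.ofReal (v x)) ≤ ∫⁻ x, ENNReal.ofReal (w x) := by
  have ht' : 0 < 1 - t := by linarith
  have lc : ∀ f : ℝ → ℝ, Measurable f → (∀ x, 0 ≤ f x) →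
      ∫⁻ x, ENNReal.ofReal (f x) = ∫⁻ r in Set.Ioi 0, volume {a | r < f a} :=
    fun f hf hf0 => lintegral_eq_lintegral_meas_lt _ (Filter.Eventually.of_forall hf0)
      hf.aemeasurable
  have meas : ∀ f : ℝ → ℝ, Measurable fun r : ℝ => volume {a | r < f a} := by
    intro f
    apply Antitone.measurable
    intro r s hrs
    apply measure_mono
    intro a (ha : s < f a)
    exact lt_of_le_of_lt hrs ha
  rw [lc u hu hu0, lc v hv hv0, lc w hw hw0, ← lintegral_const_mul _ (meas u),
    ← lintegral_const_mul _ (meas v), ← lintegral_add_left ((meas u).const_mul _)]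
  refine setLIntegral_mono (meas w) ?_
  intro r (hr : 0 < r)
  by_cases hr1 : r < 1
  · refine bm_one _ _ _ (measurableSet_lt measurable_const hu) (measurableSet_lt measurable_const hv)
      (hus r hr1) (hvs r hr1) t ht ht1 ?_
    intro x (hx : r < u x) y (hy : r < v y)
    refine lt_of_lt_of_le ?_ (h x y)
    calc r = r ^ t * r ^ (1 - t) := by
            rw [← Real.rpow_add hr]; simp
      _ < _ := by
        apply mul_lt_mul'' (Real.rpow_lt_rpow hr.le hx ht) (Real.rpow_lt_rpow hr.le hy ht')
          <;> positivity
  · have e1 : {a | r < u a} = ∅ := by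
      ext a; simp only [Set.mem_ofPred_eq, Set.mem_empty_iff_false, iff_false]
      have := hu1 a; linarith
    have e2 : {a | r < v a} = ∅ := by
      ext a; simp only [Set.mem_ofPred_eq, Set.mem_empty_iff_false, iff_false]
      have := hv1 a; linarith
    simp [e1, e2]

lemma amgm_ennreal (P Q : ℝ≥0∞) (t : ℝ) (ht : 0 < t) (ht1 : t < 1) :
    P ^ t * Q ^ (1 - t) ≤ ENNReal.ofReal t * P + ENNReal.ofReal (1 - t) * Q := by
  have ht' : 0 < 1 - t := by linarith
  by_cases hP : P = ⊤
  · rw [hP, ENNReal.mul_top (by simpa using ht)]; simp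
  by_cases hQ : Q = ⊤
  · rw [hQ, ENNReal.mul_top (by simpa using ht1)]; simp
  lift P to NNReal using hP
  lift Q to NNReal using hQ
  have := NNReal.geom_mean_le_arith_mean2_weighted t.toNNReal (1 - t).toNNReal P Q
    (by rw [← Real.toNNReal_add ht.le ht'.le]; simp)
  rw [Real.coe_toNNReal _ ht.le, Real.coe_toNNReal _ ht'.le] at this
  rw [← ENNReal.coe_rpow_of_nonneg _ ht.le, ← ENNReal.coe_rpow_of_nonneg _ ht'.le]
  unfold ENNReal.ofReal
  exact_mod_cast this

lemma pl_bdd (u v w : ℝ → ℝ≥0∞) (hu : Measurable u) (hv : Measurable v) (hw : Measurable w)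
    (N : ℝ≥0∞) (hN : N ≠ ⊤) (huN : ∀ x, u x ≤ N) (hvN : ∀ x, v x ≤ N)
    (t : ℝ) (ht : 0 < t) (ht1 : t < 1)
    (h : ∀ x y, u x ^ t * v y ^ (1 - t) ≤ w (t * x + (1 - t) * y)) :
    (∫⁻ x, u x) ^ t * (∫⁻ x, v x) ^ (1 - t) ≤ ∫⁻ x, w x := by
  have ht' : 0 < 1 - t := by linarith
  set a := ⨆ x, u x with ha
  set b := ⨆ x, v x with hb
  have haN : a ≤ N := iSup_le huN
  have hbN : b ≤ N := iSup_le hvN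
  have hat : a ≠ ⊤ := ne_top_of_le_ne_top hN haN
  have hbt : b ≠ ⊤ := ne_top_of_le_ne_top hN hbN
  have hua : ∀ x, u x ≤ a := fun x => le_iSup u x
  have hvb : ∀ x, v x ≤ b := fun x => le_iSup v x
  by_cases ha0 : a = 0
  · have : ∀ x, u x = 0 := fun x => le_antisymm (ha0 ▸ hua x) (zero_le)
    simp [this, ht]
  by_cases hb0 : b = 0
  · have : ∀ x, v x = 0 := fun x => le_antisymm (hb0 ▸ hvb x) (zero_le)
    simp [this, ht1]
  set c := a ^ t * b ^ (1 - t) with hc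
  have hc0 : c ≠ 0 := by
    simp only [hc, ne_eq, mul_eq_zero, ENNReal.rpow_eq_zero_iff, not_or]
    simp [ha0, hb0, hat, hbt]
  have hct : c ≠ ⊤ := by
    apply ENNReal.mul_ne_top
    · exact ENNReal.rpow_ne_top_of_nonneg ht.le hat
    · exact ENNReal.rpow_ne_top_of_nonneg ht'.le hbt
  have hua1 : ∀ x, u x / a ≤ 1 := fun x => ENNReal.div_le_of_le_mul (by simpa using hua x)
  have hvb1 : ∀ x, v x / b ≤ 1 := fun x => ENNReal.div_le_of_le_mul (by simpa using hvb x)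
  have sup : ∀ (f : ℝ → ℝ≥0∞) (e : ℝ≥0∞), e ≠ 0 → e ≠ ⊤ → e = ⨆ x, f x →
      ∀ r < (1:ℝ), ∃ x, r < (f x / e).toReal := by
    intro f e he0 het he r hr
    have hfe : ∀ x, f x / e ≤ 1 := fun x => ENNReal.div_le_of_le_mul
      (by rw [one_mul, he]; exact le_iSup f x)
    have : ENNReal.ofReal r * e < ⨆ x, f x := by
      rw [← he]
      calc _ < 1 * e := by
            rw [ENNReal.mul_lt_mul_iff_left he0 het]
            simpa using hr
        _ = e := one_mul e
    obtain ⟨x, hx⟩ := lt_iSup_iff.1 this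
    refine ⟨x, ?_⟩
    by_contra hcon
    push Not at hcon
    have h1 : f x / e ≤ ENNReal.ofReal r := by
      rw [← ENNReal.ofReal_toReal (ne_top_of_le_ne_top ENNReal.one_ne_top (hfe x))]
      exact ENNReal.ofReal_le_ofReal hcon
    rw [ENNReal.div_le_iff he0 het] at h1
    exact absurd hx (not_lt.2 h1)
  have main := pl_norm (fun x => (u x / a).toReal) (fun x => (v x / b).toReal)
    (fun x => (min 1 (w x / c)).toReal) (hu.div_const _).ennreal_toReal
    (hv.div_const _).ennreal_toReal (measurable_const.min (hw.div_const _)).ennreal_toReal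
    (fun x => ENNReal.toReal_nonneg) (fun x => ENNReal.toReal_nonneg)
    (fun x => ENNReal.toReal_nonneg)
    (fun x => ENNReal.toReal_mono (by simp) (hua1 x))
    (fun x => ENNReal.toReal_mono (by simp) (hvb1 x))
    (sup u a ha0 hat ha) (sup v b hb0 hbt hb) t ht ht1 (by
      intro x y
      rw [ENNReal.toReal_rpow, ENNReal.toReal_rpow, ← ENNReal.toReal_mul]
      apply ENNReal.toReal_mono (ne_top_of_le_ne_top ENNReal.one_ne_top (min_le_left _ _))
      apply le_min
      · exact mul_le_one' (ENNReal.rpow_le_one (hua1 x) ht.le) (ENNReal.rpow_le_one (hvb1 y) ht'.le)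
      · rw [ENNReal.div_rpow_of_nonneg _ _ ht.le, ENNReal.div_rpow_of_nonneg _ _ ht'.le]
        rw [ENNReal.le_div_iff_mul_le (Or.inl hc0) (Or.inl hct)]
        refine le_trans (le_of_eq ?_) (h x y)
        rw [hc]
        have h1 : a ^ t ≠ 0 := by simp [ENNReal.rpow_eq_zero_iff, ha0, hat]
        have h2 : b ^ (1 - t) ≠ 0 := by simp [ENNReal.rpow_eq_zero_iff, hb0, hbt]
        have h3 : a ^ t ≠ ⊤ := ENNReal.rpow_ne_top_of_nonneg ht.le hat
        have h4 : b ^ (1 - t) ≠ ⊤ := ENNReal.rpow_ne_top_of_nonneg ht'.le hbt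
        rw [mul_mul_mul_comm, ENNReal.div_mul_cancel h1 h3, ENNReal.div_mul_cancel h2 h4])
  have t1 : ∀ (x : ℝ≥0∞), x ≤ 1 → ENNReal.ofReal x.toReal = x := fun x hx =>
    ENNReal.ofReal_toReal (ne_top_of_le_ne_top ENNReal.one_ne_top hx)
  simp only [t1 _ (hua1 _), t1 _ (hvb1 _), t1 _ (min_le_left _ _)] at main
  have main2 := (amgm_ennreal _ _ t ht ht1).trans
    (main.trans (lintegral_mono (fun x => min_le_right _ _)))
  simp only [div_eq_mul_inv] at main2
  rw [lintegral_mul_const _ hu, lintegral_mul_const _ hv, lintegral_mul_const _ hw,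
    ← div_eq_mul_inv, ← div_eq_mul_inv, ← div_eq_mul_inv,
    ENNReal.le_div_iff_mul_le (Or.inl hc0) (Or.inl hct),
    ENNReal.div_rpow_of_nonneg _ _ ht.le, ENNReal.div_rpow_of_nonneg _ _ ht'.le, hc] at main2
  have h1 : a ^ t ≠ 0 := by simp [ENNReal.rpow_eq_zero_iff, ha0, hat]
  have h2 : b ^ (1 - t) ≠ 0 := by simp [ENNReal.rpow_eq_zero_iff, hb0, hbt]
  have h3 : a ^ t ≠ ⊤ := ENNReal.rpow_ne_top_of_nonneg ht.le hat
  have h4 : b ^ (1 - t) ≠ ⊤ := ENNReal.rpow_ne_top_of_nonneg ht'.le hbt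
  rwa [mul_mul_mul_comm, ENNReal.div_mul_cancel h1 h3, ENNReal.div_mul_cancel h2 h4] at main2

lemma pl_one (u v w : ℝ → ℝ≥0∞) (hu : Measurable u) (hv : Measurable v) (hw : Measurable w)
    (t : ℝ) (ht : 0 < t) (ht1 : t < 1)
    (h : ∀ x y, u x ^ t * v y ^ (1 - t) ≤ w (t * x + (1 - t) * y)) :
    (∫⁻ x, u x) ^ t * (∫⁻ x, v x) ^ (1 - t) ≤ ∫⁻ x, w x := by
  have ht' : 0 < 1 - t := by linarith
  by_cases hu0 : ∫⁻ x, u x = 0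
  · simp [hu0, ht]
  by_cases hv0 : ∫⁻ x, v x = 0
  · simp [hv0, ht1]
  have lim : ∀ f : ℝ → ℝ≥0∞, Measurable f →
      Filter.Tendsto (fun n : ℕ => ∫⁻ x, min (f x) n) Filter.atTop (nhds (∫⁻ x, f x)) := by
    intro f hf
    refine lintegral_tendsto_of_tendsto_of_monotone
      (fun n => (hf.min measurable_const).aemeasurable) ?_ ?_
    · refine Filter.Eventually.of_forall fun x m n hmn => ?_
      exact min_le_min_left _ (by exact_mod_cast hmn)
    · refine Filter.Eventually.of_forall fun x => ?_
      have := (tendsto_const_nhds (x := f x)).min ENNReal.tendsto_nat_nhds_top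
      simpa using this
  have L : Filter.Tendsto (fun n : ℕ => (∫⁻ x, min (u x) n) ^ t * (∫⁻ x, min (v x) n) ^ (1 - t))
      Filter.atTop (nhds ((∫⁻ x, u x) ^ t * (∫⁻ x, v x) ^ (1 - t))) := by
    refine ENNReal.Tendsto.mul ((lim u hu).ennrpow_const t) ?_ ((lim v hv).ennrpow_const (1-t)) ?_
    · left; simp only [ne_eq, ENNReal.rpow_eq_zero_iff, hu0, ht.not_gt]; simp
    · left; simp only [ne_eq, ENNReal.rpow_eq_zero_iff, hv0, ht'.not_gt]; simp
  refine le_of_tendsto' L fun n => ?_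
  refine pl_bdd _ _ w (hu.min measurable_const) (hv.min measurable_const) hw n (by simp)
    (fun x => min_le_right _ _) (fun x => min_le_right _ _) t ht ht1 ?_
  intro x y
  refine le_trans ?_ (h x y)
  gcongr
  · exact min_le_left _ _
  · exact min_le_left _ _

lemma pl_pi (n : ℕ) (u v w : (Fin n → ℝ) → ℝ≥0∞) (hu : Measurable u) (hv : Measurable v)
    (hw : Measurable w) (t : ℝ) (ht : 0 < t) (ht1 : t < 1)
    (h : ∀ x y, u x ^ t * v y ^ (1 - t) ≤ w (t • x + (1 - t) • y)) :
    (∫⁻ x, u x) ^ t * (∫⁻ x, v x) ^ (1 - t) ≤ ∫⁻ x, w x := by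
  induction n with
  | zero =>
    have key : ∀ f : (Fin 0 → ℝ) → ℝ≥0∞, ∫⁻ x, f x = f 0 := by
      intro f
      rw [volume_pi, Measure.pi_of_empty _ (0 : Fin 0 → ℝ)]
      simp
    rw [key, key, key]
    simpa using h 0 0
  | succ n ih =>
    let e := (MeasurableEquiv.piFinSuccAbove (fun _ : Fin (n+1) => ℝ) 0)
    have key : ∀ f : (Fin (n+1) → ℝ) → ℝ≥0∞, Measurable f →
        ∫⁻ x, f x = ∫⁻ a : ℝ, ∫⁻ y : Fin n → ℝ, f (e.symm (a, y)) := by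
      intro f hf
      have h1 := (volume_preserving_piFinSuccAbove (fun _ : Fin (n+1) => ℝ) 0).symm e
      rw [← h1.lintegral_comp hf]
      rw [Measure.volume_eq_prod, lintegral_prod]
      exact (hf.comp e.symm.measurable).aemeasurable
    have m : ∀ f : (Fin (n+1) → ℝ) → ℝ≥0∞, Measurable f →
        Measurable fun p : ℝ × (Fin n → ℝ) => f (e.symm p) := fun f hf => hf.comp e.symm.measurable
    rw [key u hu, key v hv, key w hw]
    refine pl_one _ _ _ (m u hu).lintegral_prod_right' (m v hv).lintegral_prod_right'
      (m w hw).lintegral_prod_right' t ht ht1 ?_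
    intro a b
    refine ih _ _ _ ((m u hu).comp measurable_prodMk_left) ((m v hv).comp measurable_prodMk_left)
      ((m w hw).comp measurable_prodMk_left) ?_
    intro x y
    refine (h _ _).trans (le_of_eq ?_)
    congr 1
    ext i
    refine Fin.cases ?_ (fun j => ?_) i <;>
    simp [e, MeasurableEquiv.piFinSuccAbove]

lemma pl_euc (n : ℕ) (u v w : EuclideanSpace ℝ (Fin n) → ℝ≥0∞) (hu : Measurable u)
    (hv : Measurable v)
    (hw : Measurable w) (t : ℝ) (ht : 0 < t) (ht1 : t < 1)
    (h : ∀ x y, u x ^ t * v y ^ (1 - t) ≤ w (t • x + (1 - t) • y)) :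
    (∫⁻ x, u x) ^ t * (∫⁻ x, v x) ^ (1 - t) ≤ ∫⁻ x, w x := by
  have P := PiLp.volume_preserving_toLp (Fin n)
  rw [← P.lintegral_comp hu, ← P.lintegral_comp hv, ← P.lintegral_comp hw]
  refine pl_pi n _ _ _ (hu.comp P.measurable) (hv.comp P.measurable) (hw.comp P.measurable)
    t ht ht1 ?_
  intro x y
  exact h _ _

lemma gauss_integrable (n : ℕ) (c : ℝ) (hc : 0 < c) (a : EuclideanSpace ℝ (Fin n)) :
    Integrable fun x : EuclideanSpace ℝ (Fin n) => Real.exp (-c * ‖x - a‖ ^ 2) := by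
  have h0 : Integrable fun x : EuclideanSpace ℝ (Fin n) => Real.exp (-c * ‖x‖ ^ 2) := by
    apply Integrable.of_integral_ne_zero
    rw [GaussianFourier.integral_rexp_neg_mul_sq_norm hc]
    have : 0 < Real.pi / c := by positivity
    positivity
  exact h0.comp_sub_right a

lemma exp_integrable_of_bound (n : ℕ) (c K : ℝ) (hc : 0 < c) (a : EuclideanSpace ℝ (Fin n))
    (f : EuclideanSpace ℝ (Fin n) → ℝ) (hf : Continuous f)
    (h : ∀ x, |f x| ≤ K * Real.exp (-c * ‖x - a‖ ^ 2)) : Integrable f := by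
  refine ((gauss_integrable n c hc a).const_mul K).mono' hf.aestronglyMeasurable ?_
  exact Filter.Eventually.of_forall h

lemma int_exp_pos (n : ℕ) (f : EuclideanSpace ℝ (Fin n) → ℝ)
    (h : Integrable fun x => Real.exp (f x)) : 0 < ∫ x, Real.exp (f x) := by
  exact _root_.MeasureTheory.integral_exp_pos h

/-- Dual transport-type inequality. -/
lemma transport_dual (n : ℕ) (V B : EuclideanSpace ℝ (Fin n) → ℝ) (hV : Continuous V)
    (hB : Continuous B) (m s V0 : ℝ) (a : EuclideanSpace ℝ (Fin n)) (hm : 0 < m)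
    (hs : 0 < s) (hs6 : s ≤ 1 / 6)
    (hVc : ∀ x y (t : ℝ), 0 < t → t < 1 → V (t • x + (1 - t) • y) ≤
      t * V x + (1 - t) * V y - m / 2 * (t * (1 - t)) * ‖x - y‖ ^ 2)
    (hVq : ∀ x, V0 + m / 2 * ‖x - a‖ ^ 2 ≤ V x)
    (hB0 : ∀ x, 0 ≤ B x) (hBq : ∀ x, B x ≤ s * m / 2 * ‖x - a‖ ^ 2)
    (hBz : ∀ x z, (1 - s) * B x ≤ B z + (1 - s) * (m / 2 * ‖x - z‖ ^ 2)) :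
    Real.log ((∫ x, Real.exp (B x - V x)) / (∫ x, Real.exp (-V x))) ≤
      (∫ x, B x * Real.exp (-V x)) / (∫ x, Real.exp (-V x)) / (1 - s) := by
  have hs1 : 0 < 1 - s := by linarith
  set Q : EuclideanSpace ℝ (Fin n) → ℝ := fun x => B x / (1 - s) with hQ
  have hQc : Continuous Q := by fun_prop
  have hQ0 : ∀ x, 0 ≤ Q x := fun x => div_nonneg (hB0 x) hs1.le
  have hQq : ∀ x, Q x ≤ m / 10 * ‖x - a‖ ^ 2 := by
    intro x
    rw [hQ]; simp only
    rw [div_le_iff₀ hs1]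
    refine (hBq x).trans ?_
    have : 0 ≤ m * ‖x - a‖ ^ 2 := by positivity
    nlinarith
  have hBQ : ∀ x, B x ≤ Q x := by
    intro x; rw [hQ]; simp only; rw [le_div_iff₀ hs1]; nlinarith [hB0 x]
  -- integrability
  have int : ∀ f : EuclideanSpace ℝ (Fin n) → ℝ, Continuous f → (∀ x, |f x| ≤
      Real.exp (2 * Q x - V x)) → Integrable f := by
    intro f hf h
    refine exp_integrable_of_bound n (3 * m / 10) (Real.exp (-V0)) (by positivity) a f hf ?_
    intro x
    refine (h x).trans ?_
    rw [← Real.exp_add]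
    apply Real.exp_le_exp.2
    linarith [hVq x, hQq x]
  have iV : Integrable fun x => Real.exp (-V x) := int _ (by fun_prop) (fun x => by
    rw [abs_of_pos (Real.exp_pos _)]; apply Real.exp_le_exp.2; linarith [hQ0 x])
  have iB : Integrable fun x => Real.exp (B x - V x) := int _ (by fun_prop) (fun x => by
    rw [abs_of_pos (Real.exp_pos _)]; apply Real.exp_le_exp.2; linarith [hQ0 x, hBQ x])
  have iT : ∀ t : ℝ, 0 < t → t < 1 → Integrable fun x => Real.exp (t * Q x - V x) :=
    fun t ht ht1 => int _ (by fun_prop) (fun x => by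
      rw [abs_of_pos (Real.exp_pos _)]; apply Real.exp_le_exp.2; nlinarith [hQ0 x])
  have iQT : ∀ t : ℝ, 0 ≤ t → t < 1 → Integrable fun x => Q x * Real.exp (t * Q x - V x) :=
    fun t ht ht1 => int _ (by fun_prop) (fun x => by
      rw [abs_of_nonneg (mul_nonneg (hQ0 x) (Real.exp_pos _).le)]
      have h1 : Q x ≤ Real.exp (Q x) := by linarith [Real.add_one_le_exp (Q x)]
      calc _ ≤ Real.exp (Q x) * Real.exp (t * Q x - V x) := by gcongr
        _ ≤ _ := by
          rw [← Real.exp_add]; apply Real.exp_le_exp.2; nlinarith [hQ0 x])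
  set Z := ∫ x, Real.exp (-V x) with hZ
  have hZ0 : 0 < Z := int_exp_pos n _ iV
  set W := ∫ x, Real.exp (B x - V x) with hW
  have hW0 : 0 < W := int_exp_pos n _ iB
  have step : ∀ t : ℝ, 0 < t → t < 1 →
      Real.log (W / Z) ≤ (∫ x, Q x * Real.exp (t * Q x - V x)) / Z := by
    intro t ht ht1
    have ht' : 0 < 1 - t := by linarith
    have pl := pl_euc n (fun x => ENNReal.ofReal (Real.exp (B x - V x)))
      (fun x => ENNReal.ofReal (Real.exp (-V x)))
      (fun x => ENNReal.ofReal (Real.exp (t * Q x - V x)))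
      (ENNReal.continuous_ofReal.comp (by fun_prop)).measurable
      (ENNReal.continuous_ofReal.comp (by fun_prop)).measurable
      (ENNReal.continuous_ofReal.comp (by fun_prop)).measurable t ht ht1 (by
        intro x y
        rw [ENNReal.ofReal_rpow_of_pos (Real.exp_pos _), ENNReal.ofReal_rpow_of_pos (Real.exp_pos _),
          ← ENNReal.ofReal_mul (by positivity), ← Real.exp_mul, ← Real.exp_mul, ← Real.exp_add]
        apply ENNReal.ofReal_le_ofReal
        apply Real.exp_le_exp.2
        have h1 := hVc x y t ht ht1
        set z := t • x + (1 - t) • y with hz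
        have h2 : B x ≤ Q z + m / 2 * ‖x - z‖ ^ 2 := by
          have := hBz x z
          have h3 : Q z * (1 - s) = B z := by rw [hQ]; field_simp
          nlinarith
        have h4 : x - z = (1 - t) • (x - y) := by rw [hz]; module
        rw [h4, norm_smul, Real.norm_eq_abs, abs_of_pos ht', mul_pow] at h2
        have h5 : 0 ≤ m * ‖x - y‖ ^ 2 := by positivity
        have h6 : (1 - t) ^ 2 * ‖x - y‖ ^ 2 ≤ (1 - t) * ‖x - y‖ ^ 2 := by
          gcongr; nlinarith
        have h7 : B x ≤ Q z + m / 2 * ((1 - t) * ‖x - y‖ ^ 2) := h2.trans (by gcongr)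
        nlinarith)
    have conv : ∀ f : EuclideanSpace ℝ (Fin n) → ℝ, Integrable (fun x => Real.exp (f x)) →
        ∫⁻ x, ENNReal.ofReal (Real.exp (f x)) = ENNReal.ofReal (∫ x, Real.exp (f x)) := by
      intro f hf
      rw [ofReal_integral_eq_lintegral_ofReal hf
        (Filter.Eventually.of_forall fun x => (Real.exp_pos _).le)]
    rw [conv _ iB, conv _ iV, conv _ (iT t ht ht1), ENNReal.ofReal_rpow_of_pos hW0,
      ENNReal.ofReal_rpow_of_pos hZ0, ← ENNReal.ofReal_mul (by positivity)] at pl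
    rw [ENNReal.ofReal_le_ofReal_iff (by positivity)] at pl
    have hle : ∫ x, Real.exp (t * Q x - V x) ≤ Z + t * ∫ x, Q x * Real.exp (t * Q x - V x) := by
      rw [hZ, ← integral_const_mul, ← integral_add iV ((iQT t ht.le ht1).const_mul t)]
      refine integral_mono (iT t ht ht1) (iV.add ((iQT t ht.le ht1).const_mul t)) fun x => ?_
      have e : Real.exp (t * Q x - V x) = Real.exp (t * Q x) * Real.exp (-V x) := by
        rw [← Real.exp_add]; ring_nf
      simp only [e]
      have h1 : Real.exp (t * Q x) ≤ 1 + t * Q x * Real.exp (t * Q x) := by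
        have h2 := Real.add_one_le_exp (-(t * Q x))
        have h3 : Real.exp (-(t * Q x)) * Real.exp (t * Q x) = 1 := by
          rw [← Real.exp_add]; simp
        nlinarith [Real.exp_pos (t * Q x)]
      nlinarith [Real.exp_pos (-V x)]
    set I := ∫ x, Q x * Real.exp (t * Q x - V x) with hI
    have h1 : W ^ t * Z ^ (1 - t) = Z * (W / Z) ^ t := by
      rw [Real.div_rpow hW0.le hZ0.le, Real.rpow_sub hZ0, Real.rpow_one]; ring
    rw [h1] at pl
    have h2 : (W / Z) ^ t ≤ 1 + t * (I / Z) := by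
      have : Z * (W / Z) ^ t ≤ Z * (1 + t * (I / Z)) := by
        refine pl.trans (hle.trans (le_of_eq ?_)); field_simp
      exact le_of_mul_le_mul_left this hZ0
    have h3 : t * Real.log (W / Z) ≤ t * (I / Z) := by
      rw [← Real.log_rpow (by positivity)]
      have := Real.log_le_sub_one_of_pos (x := (W / Z) ^ t) (by positivity)
      linarith
    exact le_of_mul_le_mul_left h3 ht
  have lim : Filter.Tendsto (fun k : ℕ => (∫ x, Q x * Real.exp ((1 / ((k:ℝ) + 1)) / 2 * Q x - V x)) / Z)
      Filter.atTop (nhds ((∫ x, Q x * Real.exp (-V x)) / Z)) := by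
    apply Filter.Tendsto.div_const
    refine tendsto_integral_of_dominated_convergence
      (fun x => Q x * Real.exp (1 / 2 * Q x - V x)) ?_ (iQT (1/2) (by norm_num) (by norm_num)) ?_ ?_
    · intro k
      exact Continuous.aestronglyMeasurable (by fun_prop)
    · intro k
      refine Filter.Eventually.of_forall fun x => ?_
      rw [Real.norm_eq_abs, abs_of_nonneg (mul_nonneg (hQ0 x) (Real.exp_pos _).le)]
      have h1 : 1 / ((k:ℝ) + 1) ≤ 1 := by
        rw [div_le_one (by positivity)]; linarith [(Nat.cast_nonneg k : (0:ℝ) ≤ k)]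
      have := hQ0 x
      gcongr
    · refine Filter.Eventually.of_forall fun x => ?_
      have h0 := tendsto_one_div_add_atTop_nhds_zero_nat (𝕜 := ℝ)
      have : Continuous fun r : ℝ => Q x * Real.exp (r / 2 * Q x - V x) := by fun_prop
      have h1 := (this.tendsto 0).comp h0
      simpa [Function.comp_def] using h1
  have fin := ge_of_tendsto' lim (fun k => step _ (by positivity) (by
      have h1 : 1 / ((k:ℝ) + 1) ≤ 1 := by
        rw [div_le_one (by positivity)]; linarith [(Nat.cast_nonneg k : (0:ℝ) ≤ k)]
      linarith))
  refine fin.trans (le_of_eq ?_)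
  rw [div_right_comm]
  congr 1
  rw [← integral_div]
  congr 1
  ext x
  rw [hQ]; ring

lemma second_moment (n : ℕ) (V : EuclideanSpace ℝ (Fin n) → ℝ) (hV : Continuous V)
    (m : ℝ) (a : EuclideanSpace ℝ (Fin n)) (hm : 0 < m)
    (hVc : ∀ x y (t : ℝ), 0 < t → t < 1 → V (t • x + (1 - t) • y) ≤
      t * V x + (1 - t) * V y - m / 2 * (t * (1 - t)) * ‖x - y‖ ^ 2)
    (hVq : ∀ x, V a + m / 2 * ‖x - a‖ ^ 2 ≤ V x) :
    (Integrable fun x => ‖x - a‖ ^ 2 * Real.exp (-V x)) ∧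
    m * (∫ x, ‖x - a‖ ^ 2 * Real.exp (-V x)) ≤ 25 / 18 * n * ∫ x, Real.exp (-V x) := by
  have int : ∀ f : EuclideanSpace ℝ (Fin n) → ℝ, Continuous f → ∀ K, (∀ x, |f x| ≤
      K * Real.exp (m / 4 * ‖x - a‖ ^ 2 - V x)) → Integrable f := by
    intro f hf K h
    refine exp_integrable_of_bound n (m / 4) (|K| * Real.exp (-V a)) (by positivity) a f hf ?_
    intro x
    refine (h x).trans ?_
    refine (mul_le_mul_of_nonneg_right (le_abs_self K) (Real.exp_pos _).le).trans ?_
    rw [mul_assoc, ← Real.exp_add]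
    gcongr
    linarith [hVq x]
  have iV : Integrable fun x => Real.exp (-V x) := int _ (by fun_prop) 1 (fun x => by
    rw [abs_of_pos (Real.exp_pos _), one_mul]; apply Real.exp_le_exp.2
    have : 0 ≤ m / 4 * ‖x - a‖ ^ 2 := by positivity
    linarith)
  have iN : Integrable fun x => ‖x - a‖ ^ 2 * Real.exp (-V x) :=
    int _ (by fun_prop) (4 / m) (fun x => by
      rw [abs_of_nonneg (by positivity)]
      have h1 : m / 4 * ‖x - a‖ ^ 2 ≤ Real.exp (m / 4 * ‖x - a‖ ^ 2) := by
        linarith [Real.add_one_le_exp (m / 4 * ‖x - a‖ ^ 2)]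
      rw [sub_eq_add_neg (m / 4 * ‖x - a‖ ^ 2), Real.exp_add, ← mul_assoc]
      gcongr
      calc ‖x - a‖ ^ 2 = 4 / m * (m / 4 * ‖x - a‖ ^ 2) := by field_simp
        _ ≤ _ := by gcongr)
  refine ⟨iN, ?_⟩
  set Z := ∫ x, Real.exp (-V x) with hZ
  have hZ0 : 0 < Z := int_exp_pos n _ iV
  set S := ∫ x, ‖x - a‖ ^ 2 * Real.exp (-V x) with hS
  set c := m / 2 * (9 / 25) * (S / Z) with hc
  -- scaled integral
  have scal : ∫ x, Real.exp (-V ((4/5 : ℝ) • (x - a) + a)) = (5 / 4) ^ n * Z := by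
    rw [integral_sub_right_eq_self (fun x => Real.exp (-V ((4/5 : ℝ) • x + a))) a]
    have := Measure.integral_comp_smul volume (fun x : EuclideanSpace ℝ (Fin n) => Real.exp (-V (x + a))) (4/5)
    rw [this, integral_add_right_eq_self (fun x => Real.exp (-V x)) a]
    simp only [finrank_euclideanSpace, Fintype.card_fin, smul_eq_mul]
    rw [abs_of_pos (by positivity), ← inv_pow]
    norm_num [hZ]
  have isc : Integrable fun x => Real.exp (-V ((4/5 : ℝ) • (x - a) + a)) := by
    have h1 : Integrable fun x => Real.exp (-V (x + a)) := iV.comp_add_right a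
    have h2 : Integrable fun x => Real.exp (-V ((4/5 : ℝ) • x + a)) :=
      h1.comp_smul (R := (4/5 : ℝ)) (by norm_num)
    exact h2.comp_sub_right a
  have pw : ∀ x, Real.exp c * ((1 - c) * Real.exp (-V x) +
      m / 2 * (9 / 25) * (‖x - a‖ ^ 2 * Real.exp (-V x))) ≤
      Real.exp (-V ((4/5 : ℝ) • (x - a) + a)) := by
    intro x
    have h1 := hVc x a (4/5) (by norm_num) (by norm_num)
    have h2 : (4/5 : ℝ) • x + (1 - 4/5 : ℝ) • a = (4/5 : ℝ) • (x - a) + a := by module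
    rw [h2] at h1
    have h3 := hVq x
    have h4 := Real.add_one_le_exp (m / 2 * (9 / 25) * ‖x - a‖ ^ 2 - c)
    calc _ = Real.exp c * Real.exp (-V x) * ((m / 2 * (9 / 25) * ‖x - a‖ ^ 2 - c) + 1) := by ring
      _ ≤ Real.exp c * Real.exp (-V x) * Real.exp (m / 2 * (9 / 25) * ‖x - a‖ ^ 2 - c) := by gcongr
      _ ≤ _ := by
        rw [← Real.exp_add, ← Real.exp_add]
        apply Real.exp_le_exp.2
        nlinarith
  have hint := integral_mono (((iV.const_mul (1 - c)).add
    (iN.const_mul (m / 2 * (9 / 25)))).const_mul (Real.exp c)) isc pw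
  simp only [Pi.add_apply] at hint
  rw [scal, integral_const_mul, integral_add (iV.const_mul (1 - c))
    (iN.const_mul (m / 2 * (9 / 25))), integral_const_mul, integral_const_mul, ← hZ, ← hS] at hint
  have h1 : (1 - c) * Z + m / 2 * (9 / 25) * S = Z := by
    rw [hc]; field_simp; ring
  rw [h1] at hint
  have h2 : Real.exp c ≤ (5 / 4) ^ n := le_of_mul_le_mul_right hint hZ0
  have h3 : c ≤ n * Real.log (5 / 4) := by
    rw [← Real.log_pow]
    exact (Real.le_log_iff_exp_le (by positivity)).2 h2
  have h4 : Real.log (5 / 4) ≤ 1 / 4 := by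
    have := Real.log_le_sub_one_of_pos (x := 5 / 4) (by norm_num)
    linarith
  have h5 : c ≤ n * (1 / 4) := h3.trans (by gcongr)
  have h6 : m * S = 50 / 9 * c * Z := by rw [hc]; field_simp; ring
  rw [h6]
  have : 50 / 9 * c * Z ≤ 50 / 9 * (n * (1 / 4)) * Z := by gcongr
  linarith

lemma mvec_eq {m n : ℕ} (A : Matrix (Fin m) (Fin n) ℝ) (x : EV n) :
    mvec A x = Matrix.toEuclideanLin A x := rfl

lemma mvec_inner {m n : ℕ} (A : Matrix (Fin m) (Fin n) ℝ) (x : EV n) :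
    ⟪x, mvec (Aᵀ * A) x⟫ = ‖mvec A x‖ ^ 2 := by
  rw [← real_inner_self_eq_norm_sq]
  simp only [mvec, EuclideanSpace.inner_eq_star_dotProduct]
  simp [← Matrix.mulVec_mulVec, Matrix.mulVec_transpose, Matrix.dotProduct_mulVec, dotProduct_comm]
  rfl

lemma sum_mvec_inner {d b : ℕ} (dd : Fin b → ℕ) (A : ∀ i, Matrix (Fin (dd i)) (Fin d) ℝ)
    (m : Fin b → ℝ) (x : EV d) :
    ⟪x, mvec (∑ i, m i • ((A i)ᵀ * A i)) x⟫ = ∑ i, m i * ‖mvec (A i) x‖ ^ 2 := by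
  have : mvec (∑ i, m i • ((A i)ᵀ * A i)) x = ∑ i, m i • mvec ((A i)ᵀ * A i) x := by
    simp only [mvec_eq, map_sum, LinearMap.sum_apply, map_smul, LinearMap.smul_apply]
  rw [this, inner_sum]
  simp only [real_inner_smul_right, mvec_inner]

lemma stacked_mul {d b : ℕ} (dd : Fin b → ℕ) (A : ∀ i, Matrix (Fin (dd i)) (Fin d) ℝ) :
    (stacked dd A)ᵀ * stacked dd A = ∑ i, (1:ℝ) • ((A i)ᵀ * A i) := by
  ext p q
  simp [Matrix.mul_apply, Matrix.sum_apply, stacked, Fintype.sum_sigma]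

lemma stacked_bound {d b : ℕ} (dd : Fin b → ℕ) (A : ∀ i, Matrix (Fin (dd i)) (Fin d) ℝ) (x : EV d) :
    ∑ i, ‖mvec (A i) x‖ ^ 2 ≤ specNorm ((stacked dd A)ᵀ * stacked dd A) * ‖x‖ ^ 2 := by
  have h := sum_mvec_inner dd A (fun _ => 1) x
  rw [← stacked_mul] at h
  simp only [one_mul] at h
  rw [← h]
  refine (real_inner_le_norm _ _).trans ?_
  have := (LinearMap.toContinuousLinearMap
    (Matrix.toEuclideanLin ((stacked dd A)ᵀ * stacked dd A))).le_opNorm x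
  have h2 : ‖mvec ((stacked dd A)ᵀ * stacked dd A) x‖ ≤
    specNorm ((stacked dd A)ᵀ * stacked dd A) * ‖x‖ := this
  nlinarith [norm_nonneg x]

lemma inner_gradient {n : ℕ} (U : EV n → ℝ) (x v : EV n) :
    ⟪gradient U x, v⟫ = fderiv ℝ U x v := by
  simp [gradient]

def toDualSymmCLM (n : ℕ) : StrongDual ℝ (EV n) →L[ℝ] EV n where
  toFun f := (InnerProductSpace.toDual ℝ (EV n)).symm f
  map_add' f g := by simp
  map_smul' c f := by simp
  cont := (InnerProductSpace.toDual ℝ (EV n)).symm.continuous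

lemma toDualSymmCLM_inner (n : ℕ) (f : StrongDual ℝ (EV n)) (v : EV n) :
    ⟪toDualSymmCLM n f, v⟫ = f v := by
  simp [toDualSymmCLM]

lemma hasFDerivAt_gradient {n : ℕ} (U : EV n → ℝ) (hU : ContDiff ℝ 2 U) (z : EV n) :
    HasFDerivAt (gradient U)
      ((toDualSymmCLM n).comp
        (fderiv ℝ (fderiv ℝ U) z)) z := by
  have h1 : DifferentiableAt ℝ (fderiv ℝ U) z :=
    ((hU.fderiv_right (m := 1) (by norm_num)).differentiable (by norm_num)) z
  exact (toDualSymmCLM n).hasFDerivAt.comp z h1.hasFDerivAt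

lemma grad_cont {n : ℕ} (U : EV n → ℝ) (hU : ContDiff ℝ 2 U) : Continuous (gradient U) :=
  continuous_iff_continuousAt.2 fun z => (hasFDerivAt_gradient U hU z).continuousAt

lemma grad_lip {n : ℕ} (U : EV n → ℝ) (hU : ContDiff ℝ 2 U) (M : ℝ) (hM : 0 ≤ M)
    (h : ∀ z v : EV n, |⟪v, fderiv ℝ (gradient U) z v⟫| ≤ M * ‖v‖ ^ 2) (x y : EV n) :
    ‖gradient U x - gradient U y‖ ≤ M * ‖x - y‖ := by
  refine Convex.norm_image_sub_le_of_norm_fderiv_le (𝕜 := ℝ) (s := Set.univ)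
    (fun z _ => (hasFDerivAt_gradient U hU z).differentiableAt) ?_ convex_univ
    (Set.mem_univ _) (Set.mem_univ _)
  intro z _
  have sym : IsSymmSndFDerivAt ℝ U z := (hU.contDiffAt).isSymmSndFDerivAt (by simp)
  set T := fderiv ℝ (gradient U) z with hT
  have hT' := (hasFDerivAt_gradient U hU z).fderiv
  have hin : ∀ v w, ⟪T v, w⟫ = fderiv ℝ (fderiv ℝ U) z v w := by
    intro v w
    rw [hT, hT']
    exact toDualSymmCLM_inner n _ _
  have hsym : (T : EV n →ₗ[ℝ] EV n).IsSymmetric := by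
    intro v w
    simp only [ContinuousLinearMap.coe_coe]
    rw [hin, real_inner_comm, hin]
    exact sym v w
  rw [T.norm_eq_iSup_rayleighQuotient hsym]
  apply ciSup_le
  intro v
  rw [ContinuousLinearMap.rayleighQuotient, abs_div, abs_of_nonneg (sq_nonneg ‖v‖)]
  apply div_le_of_le_mul₀ (by positivity) hM
  have := h z v
  rw [real_inner_comm] at this
  simpa [ContinuousLinearMap.reApplyInnerSelf_apply] using this

lemma convex_grad {n : ℕ} (U : EV n → ℝ) (hU : Differentiable ℝ U) (hc : ConvexOn ℝ Set.univ U)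
    (u z : EV n) : U u + ⟪gradient U u, z - u⟫ ≤ U z := by
  have hl : HasDerivAt (fun t : ℝ => u + t • (z - u)) (z - u) 0 := by
    simpa using ((hasDerivAt_id (0:ℝ)).smul_const (z - u)).const_add u
  have hF : HasFDerivAt U (fderiv ℝ U u) (u + (0:ℝ) • (z - u)) := by
    simpa using (hU u).hasFDerivAt
  have hd := hF.comp_hasDerivAt (0:ℝ) hl
  have hcv : ConvexOn ℝ Set.univ (U ∘ fun t : ℝ => u + t • (z - u)) := by
    have := hc.comp_affineMap (AffineMap.lineMap u z : ℝ →ᵃ[ℝ] EV n)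
    rw [Set.preimage_univ] at this
    have e : (U ∘ fun t : ℝ => u + t • (z - u)) = U ∘ (AffineMap.lineMap u z : ℝ →ᵃ[ℝ] EV n) := by
      ext t
      simp [AffineMap.lineMap_apply, add_comm]
    rw [e]
    exact this
  have := hcv.le_slope_of_hasDerivAt (Set.mem_univ 0) (Set.mem_univ 1) one_pos hd
  rw [slope_def_field] at this
  simp at this
  rw [inner_gradient, map_sub]
  linarith

lemma gauss_one (n : ℕ) (ρ : ℝ) (hρ : 0 < ρ) (a : EV n) :
    ∫ z : EV n, Real.exp (-(1 / (2 * ρ ^ 2)) * ‖z - a‖ ^ 2) =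
      (2 * Real.pi * ρ ^ 2) ^ ((n : ℝ) / 2) := by
  rw [integral_sub_right_eq_self (fun z : EV n => Real.exp (-(1 / (2 * ρ ^ 2)) * ‖z‖ ^ 2)) a,
    GaussianFourier.integral_rexp_neg_mul_sq_norm (by positivity)]
  simp only [finrank_euclideanSpace, Fintype.card_fin]
  congr 1
  field_simp

lemma uirho_bound {n : ℕ} (U : EV n → ℝ) (hU : Differentiable ℝ U) (hc : ConvexOn ℝ Set.univ U)
    (ρ : ℝ) (hρ : 0 < ρ) (u : EV n) :
    -Uirho U ρ u ≤ -U u + ρ ^ 2 / 2 * ‖gradient U u‖ ^ 2 := by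
  set c := 1 / (2 * ρ ^ 2) with hc'
  have hc0 : 0 < c := by positivity
  set g := gradient U u with hg
  set N := (2 * Real.pi * ρ ^ 2) ^ ((n : ℝ) / 2) with hN
  have hN0 : 0 < N := by positivity
  have pw : ∀ z, Real.exp (-U z - ‖z - u‖ ^ 2 / (2 * ρ ^ 2)) ≤
      Real.exp (-U u + ρ ^ 2 / 2 * ‖g‖ ^ 2) * Real.exp (-c * ‖z - (u - ρ ^ 2 • g)‖ ^ 2) := by
    intro z
    rw [← Real.exp_add]
    apply Real.exp_le_exp.2
    have h1 := convex_grad U hU hc u z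
    have h2 : z - (u - ρ ^ 2 • g) = (z - u) + ρ ^ 2 • g := by module
    rw [h2, norm_add_sq_real, norm_smul, inner_smul_right, real_inner_comm,
      Real.norm_of_nonneg (by positivity)]
    have h3 : -c * (‖z - u‖ ^ 2 + 2 * (ρ ^ 2 * ⟪g, z - u⟫) + (ρ ^ 2 * ‖g‖) ^ 2) =
      -(‖z - u‖ ^ 2 / (2 * ρ ^ 2)) - ⟪g, z - u⟫ - ρ ^ 2 / 2 * ‖g‖ ^ 2 := by
      rw [hc']; field_simp; ring
    rw [h3]
    linarith
  have iR := (gauss_integrable n c hc0 (u - ρ ^ 2 • g)).const_mul (Real.exp (-U u + ρ ^ 2 / 2 * ‖g‖ ^ 2))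
  have hUc : Continuous U := hU.continuous
  have iL : Integrable fun z => Real.exp (-U z - ‖z - u‖ ^ 2 / (2 * ρ ^ 2)) := by
    refine iR.mono' (Continuous.aestronglyMeasurable (by fun_prop)) ?_
    refine Filter.Eventually.of_forall fun z => ?_
    rw [Real.norm_of_nonneg (Real.exp_pos _).le]
    exact pw z
  have hle := integral_mono iL iR pw
  rw [integral_const_mul, gauss_one n ρ hρ] at hle
  have hpos := int_exp_pos n _ iL
  rw [Uirho, neg_neg, integral_div, Real.log_le_iff_le_exp (by positivity), div_le_iff₀ hN0]
  exact hle

lemma integral_mvec {d : ℕ} (A : Matrix (Fin d) (Fin d) ℝ) (hA : IsUnit A.det) (f : EV d → ℝ) :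
    ∫ θ, f (mvec A θ) = |A.det⁻¹| * ∫ x, f x := by
  have hdet : LinearMap.det (Matrix.toEuclideanLin A) = A.det := by
    change LinearMap.det (Matrix.toLpLin 2 2 A) = A.det
    rw [Matrix.toLpLin_eq_toLin, LinearMap.det_toLin]
  have hne : LinearMap.det (Matrix.toEuclideanLin A) ≠ 0 := by
    rw [hdet]; exact hA.ne_zero
  let e := (LinearMap.equivOfDetNeZero _ hne).toContinuousLinearEquiv.toHomeomorph.toMeasurableEquiv
  have h1 := integral_map_equiv (μ := volume) e f
  have he : (e : EV d → EV d) = Matrix.toEuclideanLin A := rfl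
  rw [he, Measure.map_linearMap_addHaar_eq_smul_addHaar _ hne, integral_smul_measure, hdet] at h1
  simp only [mvec_eq]
  rw [← h1, ENNReal.toReal_ofReal (abs_nonneg _), smul_eq_mul]

lemma part_one {d : ℕ} (U : EV d → ℝ) (hb : BddBelow (Set.range U))
    (hi : Integrable fun z : EV d => Real.exp (-U z)) (ρ : ℝ) (hρ : 0 < ρ) :
    ∫ x, Real.exp (-U x) = ∫ x, Real.exp (-Uirho U ρ x) := by
  set c := 1 / (2 * ρ ^ 2) with hc'
  have hc0 : 0 < c := by positivity
  set N := (2 * Real.pi * ρ ^ 2) ^ ((d : ℝ) / 2) with hN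
  have hN0 : 0 < N := by positivity
  have e1 : ∀ u z : EV d, Real.exp (-U z - ‖z - u‖ ^ 2 / (2 * ρ ^ 2)) =
      Real.exp (-U z) * Real.exp (-c * ‖u - z‖ ^ 2) := by
    intro u z
    rw [← Real.exp_add, norm_sub_rev u z, hc']
    congr 1
    ring
  have i1 : ∀ u : EV d, Integrable fun z => Real.exp (-U z - ‖z - u‖ ^ 2 / (2 * ρ ^ 2)) := by
    intro u
    simp only [e1]
    refine hi.mul_bdd (c := 1) (Continuous.aestronglyMeasurable (by fun_prop)) ?_
    refine Filter.Eventually.of_forall fun z => ?_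
    rw [Real.norm_of_nonneg (Real.exp_pos _).le, Real.exp_le_one_iff]
    have : 0 ≤ c * ‖u - z‖ ^ 2 := by positivity
    linarith
  have e2 : ∀ u : EV d, Real.exp (-Uirho U ρ u) =
      (convolution (fun z => Real.exp (-U z)) (fun z => Real.exp (-c * ‖z‖ ^ 2) / N)
        (ContinuousLinearMap.mul ℝ ℝ) volume) u := by
    intro u
    have hpos := int_exp_pos d _ (i1 u)
    rw [Uirho, neg_neg, integral_div, Real.exp_log (by positivity), ← integral_div]
    simp only [convolution, ContinuousLinearMap.mul_apply', e1]
    congr 1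
    ext z
    rw [mul_div_assoc]
  simp only [e2]
  have ig : Integrable fun z : EV d => Real.exp (-c * ‖z‖ ^ 2) / N := by
    simpa using (gauss_integrable d c hc0 0).div_const N
  rw [integral_convolution _ hi ig]
  have g1 : ∫ z : EV d, Real.exp (-c * ‖z‖ ^ 2) = N := by
    have := gauss_one d ρ hρ 0
    simp only [sub_zero] at this
    exact this
  rw [integral_div, g1, div_self hN0.ne']
  simp

lemma integral_densMeasure {d : ℕ} (V B : EV d → ℝ) (hV : Continuous V)
    (hi : Integrable fun x => Real.exp (-V x)) :
    ∫ x, B x ∂(densMeasure fun x => Real.exp (-V x)) =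
      (∫ x, B x * Real.exp (-V x)) / ∫ x, Real.exp (-V x) := by
  rw [densMeasure, integral_smul_measure, integral_withDensity_eq_integral_toReal_smul]
  · rw [← ofReal_integral_eq_lintegral_ofReal hi
      (Filter.Eventually.of_forall fun x => (Real.exp_pos _).le), ENNReal.toReal_inv,
      ENNReal.toReal_ofReal (integral_nonneg fun x => (Real.exp_pos _).le), smul_eq_mul,
      div_eq_inv_mul]
    congr 2
    ext x
    rw [ENNReal.toReal_ofReal (Real.exp_pos _).le, smul_eq_mul, mul_comm]
  · exact (ENNReal.continuous_ofReal.comp (by fun_prop)).measurable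
  · exact Filter.Eventually.of_forall fun x => ENNReal.ofReal_lt_top

lemma strong_ineq {n : ℕ} (U : EV n → ℝ) (m : ℝ)
    (h : ConvexOn ℝ Set.univ fun z => U z - m / 2 * ‖z‖ ^ 2) (x y : EV n) (t : ℝ) (ht : 0 < t)
    (ht1 : t < 1) :
    U (t • x + (1 - t) • y) ≤ t * U x + (1 - t) * U y - m / 2 * (t * (1 - t)) * ‖x - y‖ ^ 2 := by
  have h1 := (strongConvexOn_iff_convex.2 h).2 (Set.mem_univ x) (Set.mem_univ y) ht.le
    (by linarith : 0 ≤ 1 - t) (by ring)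
  simp only [smul_eq_mul] at h1
  linarith

lemma min_quad {n : ℕ} (V : EV n → ℝ) (m : ℝ) (a : EV n)
    (hVc : ∀ x y (t : ℝ), 0 < t → t < 1 → V (t • x + (1 - t) • y) ≤
      t * V x + (1 - t) * V y - m / 2 * (t * (1 - t)) * ‖x - y‖ ^ 2)
    (ha : ∀ x, V a ≤ V x) (x : EV n) : V a + m / 2 * ‖x - a‖ ^ 2 ≤ V x := by
  have key : ∀ t : ℝ, 0 < t → t < 1 → V a + m / 2 * (1 - t) * ‖x - a‖ ^ 2 ≤ V x := by
    intro t ht ht1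
    have h1 := hVc x a t ht ht1
    have h2 := ha (t • x + (1 - t) • a)
    have : t * (V a + m / 2 * (1 - t) * ‖x - a‖ ^ 2) ≤ t * V x := by nlinarith
    exact le_of_mul_le_mul_left this ht
  have lim : Filter.Tendsto (fun t : ℝ => V a + m / 2 * (1 - t) * ‖x - a‖ ^ 2)
      (nhdsWithin 0 (Set.Ioi 0)) (nhds (V a + m / 2 * ‖x - a‖ ^ 2)) := by
    have : Continuous (fun t : ℝ => V a + m / 2 * (1 - t) * ‖x - a‖ ^ 2) := by fun_prop
    have h := this.tendsto 0
    simp only [sub_zero, mul_one] at h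
    exact h.mono_left nhdsWithin_le_nhds
  refine le_of_tendsto lim ?_
  filter_upwards [Ioo_mem_nhdsGT (zero_lt_one (α := ℝ))] with t ht
  exact key t ht.1 ht.2

lemma young_vec {n : ℕ} (a c : EV n) (s : ℝ) (hs : 0 < s) (hs1 : s < 1) :
    s * (1 - s) * ‖a + c‖ ^ 2 ≤ s * ‖a‖ ^ 2 + (1 - s) * ‖c‖ ^ 2 := by
  have h : 0 ≤ ‖s • a - (1 - s) • c‖ ^ 2 := sq_nonneg _
  rw [norm_sub_sq_real, norm_smul, norm_smul, inner_smul_left, inner_smul_right,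
    Real.norm_of_nonneg hs.le, Real.norm_of_nonneg (by linarith : 0 ≤ 1 - s)] at h
  simp only [conj_trivial] at h
  rw [norm_add_sq_real]
  nlinarith

theorem stmt18 {d b : ℕ} (hd : 0 < d) (hb : 0 < b)
    (dd : Fin b → ℕ) (hdd : ∀ i, 0 < dd i)
    (A : ∀ i, Matrix (Fin (dd i)) (Fin d) ℝ) (U : ∀ i, EV (dd i) → ℝ)
    (M m : Fin b → ℝ) (ρ : ℝ) (hρ : 0 < ρ)
    -- (A0)
    (hA0bdd : ∀ j, BddBelow (Set.range (U j)))
    (hA0 : ∃ i, ∃ h : dd i = d,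
      IsUnit (Matrix.det (Matrix.reindex (finCongr h) (Equiv.refl (Fin d)) (A i))) ∧
      Integrable fun z : EV (dd i) => Real.exp (-U i z))
    -- (A2)
    (hC2 : ∀ i, ContDiff ℝ 2 (U i))
    (hHess : ∀ i (z v : EV (dd i)), |⟪v, fderiv ℝ (gradient (U i)) z v⟫| ≤ M i * ‖v‖ ^ 2)
    -- (A4)
    (hm : ∀ i, 0 ≤ m i)
    (hsc : ∀ i, ConvexOn ℝ Set.univ fun z => U i z - m i / 2 * ‖z‖ ^ 2)
    -- (A6)
    (θstar : EV d)
    (hminU : ∀ θ, (∑ i, U i (mvec (A i) θstar)) ≤ ∑ i, U i (mvec (A i) θ))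
    (hA6 : ∀ i, gradient (U i) (mvec (A i) θstar) = 0)
    -- det(Σᵢ mᵢAᵢᵀAᵢ) > 0
    (hdet : 0 < (∑ i, m i • ((A i)ᵀ * A i)).det)
    -- m_U = λ_min(Σᵢ mᵢAᵢᵀAᵢ)
    (mU : ℝ)
    (hmU : IsGreatest
      {c : ℝ | ∀ x : EV d, c * ‖x‖ ^ 2 ≤ ⟪x, mvec (∑ i, m i • ((A i)ᵀ * A i)) x⟫} mU)
    -- maxᵢ Mᵢ
    (Mmax : ℝ) (hMmax : IsGreatest (Set.range M) Mmax) :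
    -- (i) single splitting: Z_π = Z_{π_ρ}
    (∀ (U₁ : EV d → ℝ) (A₁ : Matrix (Fin d) (Fin d) ℝ),
      BddBelow (Set.range U₁) → IsUnit A₁.det →
      (Integrable fun z : EV d => Real.exp (-U₁ z)) →
      ∀ ρ' : ℝ, 0 < ρ' →
        (∫ θ : EV d, Real.exp (-U₁ (mvec A₁ θ))) =
          ∫ θ : EV d, Real.exp (-Uirho U₁ ρ' (mvec A₁ θ))) ∧
    -- (ii) multiple splitting lower bound on log(Z_π/Z_{π_ρ})
    (ρ ^ 2 ≤ 1 / (6 * (specNorm ((stacked dd A)ᵀ * stacked dd A) * Mmax ^ 2 / mU)) →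
      -(∫ θ, (ρ ^ 2 / 2 * ∑ i, ‖gradient (U i) (mvec (A i) θ)‖ ^ 2)
            ∂(densMeasure fun θ : EV d => Real.exp (-(∑ i, U i (mvec (A i) θ))))) -
          ρ ^ 4 * (2 + d) *
            (specNorm ((stacked dd A)ᵀ * stacked dd A) * Mmax ^ 2 / mU) ^ 2 ≤
        Real.log ((∫ θ : EV d, Real.exp (-(∑ i, U i (mvec (A i) θ)))) /
          (∫ θ : EV d, Real.exp (-(∑ i, Uirho (U i) ρ (mvec (A i) θ)))))) := by
  refine ⟨?_, ?_⟩
  · intro U₁ A₁ hb1 hA1 hi1 ρ' hρ'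
    rw [integral_mvec A₁ hA1 (fun x => Real.exp (-U₁ x)),
      integral_mvec A₁ hA1 (fun x => Real.exp (-Uirho U₁ ρ' x)), part_one U₁ hb1 hi1 ρ' hρ']
  intro hρ6
  set K := specNorm ((stacked dd A)ᵀ * stacked dd A) with hK
  have hK0 : 0 ≤ K := norm_nonneg _
  set σ := K * Mmax ^ 2 / mU with hσ
  have hσ0 : 0 < σ := by
    have h1 : 0 < 1 / (6 * σ) := lt_of_lt_of_le (by positivity) hρ6
    have h2 : 0 < 6 * σ := one_div_pos.1 h1
    linarith
  have hmU0 : 0 < mU := by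
    by_contra hcon
    have : σ ≤ 0 := div_nonpos_of_nonneg_of_nonpos (by positivity) (not_lt.1 hcon)
    linarith
  set s := ρ ^ 2 * σ with hs
  have hs0 : 0 < s := by positivity
  have hs6 : s ≤ 1 / 6 := by
    rw [le_div_iff₀ (by positivity)] at hρ6
    rw [hs]; linarith
  have hsm : ρ ^ 2 * (Mmax ^ 2 * K) = s * mU := by
    rw [hs, hσ]; field_simp
  have hM0 : ∀ i, 0 ≤ M i := by
    intro i
    have h1 := hHess i 0 (EuclideanSpace.single ⟨0, hdd i⟩ 1)
    have h2 := (abs_nonneg _).trans h1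
    simpa using h2
  have hMm : ∀ i, M i ≤ Mmax := fun i => hMmax.2 ⟨i, rfl⟩
  have hUc : ∀ i, Continuous (U i) := fun i => (hC2 i).continuous
  have hUd : ∀ i, Differentiable ℝ (U i) := fun i => (hC2 i).differentiable (by norm_num)
  have hgc : ∀ i, Continuous (gradient (U i)) := fun i => grad_cont _ (hC2 i)
  have hAc : ∀ i, Continuous (mvec (A i)) := fun i => by
    have : mvec (A i) = Matrix.toEuclideanLin (A i) := by ext1 x; exact mvec_eq _ _
    rw [this]; exact LinearMap.continuous_of_finiteDimensional _
  have hAsub : ∀ i x y, mvec (A i) (x - y) = mvec (A i) x - mvec (A i) y := by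
    intro i x y; simp only [mvec_eq, map_sub]
  set V : EV d → ℝ := fun θ => ∑ i, U i (mvec (A i) θ) with hV
  have hVcont : Continuous V := by
    rw [hV]; exact continuous_finsetSum _ fun i _ => (hUc i).comp (hAc i)
  set B : EV d → ℝ := fun θ => ρ ^ 2 / 2 * ∑ i, ‖gradient (U i) (mvec (A i) θ)‖ ^ 2 with hB
  have hBcont : Continuous B := by
    rw [hB]
    exact continuous_const.mul
      (continuous_finsetSum _ fun i _ => (((hgc i).comp (hAc i)).norm).pow 2)
  have hVc : ∀ x y (t : ℝ), 0 < t → t < 1 → V (t • x + (1 - t) • y) ≤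
      t * V x + (1 - t) * V y - mU / 2 * (t * (1 - t)) * ‖x - y‖ ^ 2 := by
    intro x y t ht ht1
    have h1 := hmU.1 (x - y)
    rw [sum_mvec_inner] at h1
    have h2 : V (t • x + (1 - t) • y) ≤ ∑ i, (t * U i (mvec (A i) x) + (1 - t) * U i (mvec (A i) y)
        - m i / 2 * (t * (1 - t)) * ‖mvec (A i) (x - y)‖ ^ 2) := by
      rw [hV]
      refine Finset.sum_le_sum fun i _ => ?_
      have h3 := strong_ineq (U i) (m i) (hsc i) (mvec (A i) x) (mvec (A i) y) t ht ht1
      rw [hAsub]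
      have h4 : mvec (A i) (t • x + (1 - t) • y) = t • mvec (A i) x + (1 - t) • mvec (A i) y := by
        simp only [mvec_eq, map_add, map_smul]
      rw [h4]
      exact h3
    have h5 : ∑ i, (t * U i (mvec (A i) x) + (1 - t) * U i (mvec (A i) y)
        - m i / 2 * (t * (1 - t)) * ‖mvec (A i) (x - y)‖ ^ 2) =
        t * V x + (1 - t) * V y - (t * (1 - t)) / 2 * ∑ i, m i * ‖mvec (A i) (x - y)‖ ^ 2 := by
      rw [Finset.sum_sub_distrib, Finset.sum_add_distrib, hV, Finset.mul_sum, Finset.mul_sum,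
        Finset.mul_sum]
      congr 1
      refine Finset.sum_congr rfl fun i _ => ?_
      ring
    rw [h5] at h2
    have h6 : 0 < t * (1 - t) := mul_pos ht (by linarith)
    nlinarith
  have hVq := min_quad V mU θstar hVc hminU
  have hB0 : ∀ x, 0 ≤ B x := fun x => by rw [hB]; positivity
  have hlip : ∀ x z, ∑ i, ‖gradient (U i) (mvec (A i) x) - gradient (U i) (mvec (A i) z)‖ ^ 2 ≤
      Mmax ^ 2 * K * ‖x - z‖ ^ 2 := by
    intro x z
    calc _ ≤ ∑ i, Mmax ^ 2 * ‖mvec (A i) (x - z)‖ ^ 2 := by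
          refine Finset.sum_le_sum fun i _ => ?_
          rw [← mul_pow]
          have h1 := grad_lip (U i) (hC2 i) (M i) (hM0 i) (hHess i) (mvec (A i) x) (mvec (A i) z)
          rw [← hAsub] at h1
          have h2 : M i * ‖mvec (A i) (x - z)‖ ≤ Mmax * ‖mvec (A i) (x - z)‖ := by
            gcongr; exact hMm i
          exact pow_le_pow_left₀ (norm_nonneg _) (h1.trans h2) 2
      _ ≤ _ := by
          rw [← Finset.mul_sum, mul_assoc]
          gcongr
          exact stacked_bound dd A (x - z)
  have hBq : ∀ x, B x ≤ s * mU / 2 * ‖x - θstar‖ ^ 2 := by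
    intro x
    have h1 := hlip x θstar
    simp only [hA6, sub_zero] at h1
    have h2 : B x ≤ ρ ^ 2 / 2 * (Mmax ^ 2 * K * ‖x - θstar‖ ^ 2) := by
      rw [hB]; simp only; gcongr
    refine h2.trans (le_of_eq ?_)
    rw [← hsm]; ring
  have hBz : ∀ x z, (1 - s) * B x ≤ B z + (1 - s) * (mU / 2 * ‖x - z‖ ^ 2) := by
    intro x z
    have h1 := hlip x z
    have h2 : s * (1 - s) * ∑ i, ‖gradient (U i) (mvec (A i) x)‖ ^ 2 ≤
        s * ∑ i, ‖gradient (U i) (mvec (A i) z)‖ ^ 2 + (1 - s) *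
        ∑ i, ‖gradient (U i) (mvec (A i) x) - gradient (U i) (mvec (A i) z)‖ ^ 2 := by
      rw [Finset.mul_sum, Finset.mul_sum, Finset.mul_sum, ← Finset.sum_add_distrib]
      refine Finset.sum_le_sum fun i _ => ?_
      have h3 := young_vec (gradient (U i) (mvec (A i) z))
        (gradient (U i) (mvec (A i) x) - gradient (U i) (mvec (A i) z)) s hs0 (by linarith)
      rwa [add_sub_cancel] at h3
    have h4 : s * ((1 - s) * B x) ≤ s * (B z + (1 - s) * (mU / 2 * ‖x - z‖ ^ 2)) := by
      calc s * ((1 - s) * B x) =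
          ρ ^ 2 / 2 * (s * (1 - s) * ∑ i, ‖gradient (U i) (mvec (A i) x)‖ ^ 2) := by rw [hB]; ring
        _ ≤ ρ ^ 2 / 2 * (s * ∑ i, ‖gradient (U i) (mvec (A i) z)‖ ^ 2 + (1 - s) *
              (Mmax ^ 2 * K * ‖x - z‖ ^ 2)) := by
            have : 0 ≤ 1 - s := by linarith
            refine mul_le_mul_of_nonneg_left (h2.trans ?_) (by positivity)
            gcongr
        _ = s * B z + (1 - s) / 2 * (ρ ^ 2 * (Mmax ^ 2 * K)) * ‖x - z‖ ^ 2 := by rw [hB]; ring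
        _ = _ := by rw [hsm]; ring
    exact le_of_mul_le_mul_left h4 hs0
  have td := transport_dual d V B hVcont hBcont mU s (V θstar) θstar hmU0 hs0 hs6 hVc hVq hB0 hBq hBz
  obtain ⟨iN, sm⟩ := second_moment d V hVcont mU θstar hmU0 hVc hVq
  have hnn : ∀ x : EV d, 0 ≤ mU * ‖x - θstar‖ ^ 2 := fun x => by positivity
  have iV : Integrable fun x => Real.exp (-V x) := by
    refine exp_integrable_of_bound d (mU / 2) (Real.exp (-V θstar)) (by positivity) θstar _
      (by fun_prop) fun x => ?_
    rw [abs_of_pos (Real.exp_pos _), ← Real.exp_add]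
    apply Real.exp_le_exp.2
    linarith [hVq x]
  have iBV : Integrable fun x => Real.exp (B x - V x) := by
    refine exp_integrable_of_bound d (mU / 4) (Real.exp (-V θstar)) (by positivity) θstar _
      (by fun_prop) fun x => ?_
    rw [abs_of_pos (Real.exp_pos _), ← Real.exp_add]
    apply Real.exp_le_exp.2
    have := hBq x
    nlinarith [hVq x, hnn x]
  have hE := integral_densMeasure V B hVcont iV
  set Z := ∫ x, Real.exp (-V x) with hZ
  have hZ0 : 0 < Z := int_exp_pos d _ iV
  set E := (∫ x, B x * Real.exp (-V x)) / Z with hEdef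
  have hEle : E ≤ s / 2 * (25 / 18 * d) := by
    rw [hEdef, div_le_iff₀ hZ0]
    calc ∫ x, B x * Real.exp (-V x) ≤
        ∫ x, s * mU / 2 * (‖x - θstar‖ ^ 2 * Real.exp (-V x)) := by
          refine integral_mono_of_nonneg
            (Filter.Eventually.of_forall fun x => mul_nonneg (hB0 x) (Real.exp_pos _).le)
            (iN.const_mul _) (Filter.Eventually.of_forall fun x => ?_)
          simp only
          rw [← mul_assoc]
          exact mul_le_mul_of_nonneg_right (hBq x) (Real.exp_pos _).le
      _ = s / 2 * (mU * ∫ x, ‖x - θstar‖ ^ 2 * Real.exp (-V x)) := by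
          rw [integral_const_mul]; ring
      _ ≤ s / 2 * (25 / 18 * d * Z) := by gcongr
      _ = _ := by ring
  have hE0 : 0 ≤ E := div_nonneg (integral_nonneg fun x => mul_nonneg (hB0 x) (Real.exp_pos _).le)
    hZ0.le
  have hE1 : E / (1 - s) ≤ E + s ^ 2 * (2 + d) := by
    rw [div_le_iff₀ (by linarith)]
    have hd0 : (0:ℝ) ≤ d := Nat.cast_nonneg d
    have h1 : s * E ≤ s * (s / 2 * (25 / 18 * d)) := by gcongr
    have h2 : 0 ≤ s ^ 2 * d := by positivity
    have h3 : s * (s ^ 2 * d) ≤ 1 / 6 * (s ^ 2 * d) := by gcongr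
    have h4 : 0 ≤ s ^ 2 * (1 - s) := mul_nonneg (sq_nonneg _) (by linarith)
    nlinarith
  have hle : ∫ θ, Real.exp (-(∑ i, Uirho (U i) ρ (mvec (A i) θ))) ≤ ∫ x, Real.exp (B x - V x) := by
    refine integral_mono_of_nonneg (Filter.Eventually.of_forall fun x => (Real.exp_pos _).le) iBV
      (Filter.Eventually.of_forall fun x => ?_)
    apply Real.exp_le_exp.2
    have h1 : ∑ i, -Uirho (U i) ρ (mvec (A i) x) ≤ ∑ i, (-U i (mvec (A i) x) +
        ρ ^ 2 / 2 * ‖gradient (U i) (mvec (A i) x)‖ ^ 2) := by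
      refine Finset.sum_le_sum fun i _ => ?_
      refine uirho_bound (U i) (hUd i) ?_ ρ hρ _
      refine ⟨convex_univ, fun x _ y _ a b ha hb hab => ?_⟩
      have h2 := (strongConvexOn_iff_convex.2 (hsc i)).2 (Set.mem_univ x) (Set.mem_univ y) ha hb hab
      have h3 : 0 ≤ a * b * (m i / 2 * ‖x - y‖ ^ 2) := by
        have := hm i
        positivity
      simp only [smul_eq_mul] at h2 ⊢
      linarith
    rw [Finset.sum_neg_distrib, Finset.sum_add_distrib, Finset.sum_neg_distrib,
      ← Finset.mul_sum] at h1
    rw [hB, hV]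
    simp only
    linarith
  rw [hE]
  have hgoal : ρ ^ 4 * (2 + (d:ℝ)) * σ ^ 2 = s ^ 2 * (2 + d) := by rw [hs]; ring
  rw [hgoal]
  set Zr := ∫ θ, Real.exp (-(∑ i, Uirho (U i) ρ (mvec (A i) θ))) with hZr
  have hZr0 : 0 ≤ Zr := integral_nonneg fun x => (Real.exp_pos _).le
  rcases hZr0.eq_or_lt with h0 | h0
  · rw [← h0, div_zero, Real.log_zero]
    have : 0 ≤ s ^ 2 * (2 + (d:ℝ)) := by positivity
    linarith
  · set W := ∫ x, Real.exp (B x - V x) with hW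
    have hW0 : 0 < W := int_exp_pos d _ iBV
    rw [Real.log_div hZ0.ne' h0.ne']
    rw [Real.log_div hW0.ne' hZ0.ne'] at td
    have := Real.log_le_log h0 hle
    linarith

end
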